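/- Let V: ℝ^d → ℝ be differentiable, let π be a probability measure on ℝ^d, and let (𝒢, Γ) be a stochastic gradient approximation of V, i.e. E_{ω∼Γ}[𝒢(x, ω)] = ∇V(x) for every x. Fix h > 0, γ > 0, and p ∈ {1, 2}, and for each x ∈ ℝ^d let μ_x denote the law of h·e^{−hγ/2}·(∇V(x) − 𝒢(x, ω)) for ω ∼ Γ. Assume σ_{2p} = (E_{X∼π, ω∼Γ} ‖𝒢(X,ω) − ∇V(X)‖^{2p})^{1/(2p)} < ∞. Then (E_{x∼π} W_p^p(μ_x * γ̂, γ̂))^{1/p} ≤ (K_p / (1 − (1 − 2^{−2p})^{1/p})) · h² e^{−hγ} · σ_{2p}², where γ̂ = N(0, I_d), K_p = max{1, C_p/2 + 1/3}, and C_p = (E_{ξ∼N(0,1)} |ξ|^p)^{1/p}. -/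

import Mathlib

open MeasureTheory ProbabilityTheory Real ENNReal RealInnerProductSpace

noncomputable section

/-- The set of couplings of two measures `μ` and `ν`. -/
def couplings {E : Type*} [MeasurableSpace E] (μ ν : Measure E) : Set (Measure (E × E)) :=
  {τ | τ.map Prod.fst = μ ∧ τ.map Prod.snd = ν}

/-- The Wasserstein-`p` distance, valued in `ℝ≥0∞`:
`W_p(μ,ν) = (inf over couplings τ of ∫ ‖z₁ - z₂‖^p dτ)^{1/p}`. -/
noncomputable def Wp {E : Type*} [MeasurableSpace E] [NormedAddCommGroup E]
    (p : ℝ) (μ ν : Measure E) : ℝ≥0∞ :=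
  (⨅ τ ∈ couplings μ ν, ∫⁻ z : E × E, ENNReal.ofReal (‖z.1 - z.2‖ ^ p) ∂τ) ^ (1 / p)

/-- The standard Gaussian measure `N(0, I_d)` on `ℝ^d`. -/
noncomputable def stdGaussian (d : ℕ) : Measure (EuclideanSpace ℝ (Fin d)) :=
  (Measure.pi fun _ : Fin d => gaussianReal 0 1).map
    ((EuclideanSpace.equiv (Fin d) ℝ).symm : (Fin d → ℝ) → EuclideanSpace ℝ (Fin d))

/-- The Gaussian measure `N(m, I_d)` on `ℝ^d`. -/
noncomputable def gaussianE (d : ℕ) (m : EuclideanSpace ℝ (Fin d)) :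
    Measure (EuclideanSpace ℝ (Fin d)) :=
  (stdGaussian d).map (fun x => m + x)

/-- `C_p = (E_{ξ ∼ N(0,1)} |ξ|^p)^{1/p}`. -/
noncomputable def Cconst (p : ℝ) : ℝ := (∫ ξ : ℝ, |ξ| ^ p ∂(gaussianReal 0 1)) ^ (1 / p)

/-- `K_p = max {1, C_p/2 + 1/3}`. -/
noncomputable def Kconst (p : ℝ) : ℝ := max 1 (Cconst p / 2 + 1 / 3)

/-- The constant `c₄ = (e⁴ - 5)/16`. -/
noncomputable def cFour : ℝ := (Real.exp 4 - 5) / 16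

/-- The (second-moment) covariance matrix `∫ x xᵀ dμ` of a (centred) measure on `ℝ^d`. -/
noncomputable def covMat {d : ℕ} (μ : Measure (EuclideanSpace ℝ (Fin d))) :
    Matrix (Fin d) (Fin d) ℝ :=
  Matrix.of fun i j => ∫ x, x i * x j ∂μ

/-- The Frobenius norm of a matrix. -/
noncomputable def frob {d : ℕ} (A : Matrix (Fin d) (Fin d) ℝ) : ℝ :=
  Real.sqrt (∑ i, ∑ j, (A i j) ^ 2)

/-- `τ₁ = E[‖X‖ 1_{‖X‖ > 1}]`. -/
noncomputable def tailOne {d : ℕ} (μ : Measure (EuclideanSpace ℝ (Fin d))) : ℝ :=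
  ∫ x in {x : EuclideanSpace ℝ (Fin d) | 1 < ‖x‖}, ‖x‖ ∂μ

/-- `τ₂ = (E[‖X‖² 1_{‖X‖ > 1}])^{1/2}`. -/
noncomputable def tailTwo {d : ℕ} (μ : Measure (EuclideanSpace ℝ (Fin d))) : ℝ :=
  Real.sqrt (∫ x in {x : EuclideanSpace ℝ (Fin d) | 1 < ‖x‖}, ‖x‖ ^ 2 ∂μ)

/-- `m = E[X 1_{‖X‖ ≤ 1}]`. -/
noncomputable def truncMean {d : ℕ} (μ : Measure (EuclideanSpace ℝ (Fin d))) :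
    EuclideanSpace ℝ (Fin d) :=
  ∫ x in {x : EuclideanSpace ℝ (Fin d) | ‖x‖ ≤ 1}, x ∂μ

/-- `X̃ = X 1_{‖X‖ ≤ 1} - E[X 1_{‖X‖ ≤ 1}]`, as a function of `X`. -/
noncomputable def truncCentred {d : ℕ} (μ : Measure (EuclideanSpace ℝ (Fin d)))
    (x : EuclideanSpace ℝ (Fin d)) : EuclideanSpace ℝ (Fin d) :=
  (if ‖x‖ ≤ 1 then x else 0) - truncMean μ

/-- `Σ̃ = Cov(X̃) = E[X̃ X̃ᵀ]` (note `X̃` is centred). -/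
noncomputable def truncCov {d : ℕ} (μ : Measure (EuclideanSpace ℝ (Fin d))) :
    Matrix (Fin d) (Fin d) ℝ :=
  Matrix.of fun i j => ∫ x, truncCentred μ x i * truncCentred μ x j ∂μ

/-- The chi-squared divergence `χ²(ρ ‖ γ) = ∫ ((dρ/dγ) - 1)² dγ`. -/
noncomputable def chiSqDiv {E : Type*} [MeasurableSpace E] (ρ γm : Measure E) : ℝ :=
  ∫ x, ((ρ.rnDeriv γm x).toReal - 1) ^ 2 ∂γm

/-- The Kullback–Leibler divergence `KL(ρ ‖ γ) = ∫ log (dρ/dγ) dρ`. -/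
noncomputable def klDivReal {E : Type*} [MeasurableSpace E] (ρ γm : Measure E) : ℝ :=
  ∫ x, Real.log ((ρ.rnDeriv γm x).toReal) ∂ρ

/-- The Jacobian matrix `∇φ(x)` of a map `φ : ℝ^d → ℝ^d`, with entry `(i,j)` equal to
`∂φ_i/∂x_j (x)`. -/
noncomputable def jacobianM {d : ℕ}
    (φ : EuclideanSpace ℝ (Fin d) → EuclideanSpace ℝ (Fin d))
    (x : EuclideanSpace ℝ (Fin d)) : Matrix (Fin d) (Fin d) ℝ :=
  Matrix.of fun i j => fderiv ℝ φ x (EuclideanSpace.single j (1 : ℝ)) i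

/-- `τ` is a Stein kernel for the centred measure `ρ` relative to the standard Gaussian:
for all `φ ∈ C_c^∞(ℝ^d; ℝ^d)`, `E⟨X, φ(X)⟩ = E[tr(τ(X) ∇φ(X))]`. -/
def IsSteinKernel {d : ℕ} (ρ : Measure (EuclideanSpace ℝ (Fin d)))
    (τ : EuclideanSpace ℝ (Fin d) → Matrix (Fin d) (Fin d) ℝ) : Prop :=
  ∀ φ : EuclideanSpace ℝ (Fin d) → EuclideanSpace ℝ (Fin d),
    ContDiff ℝ (⊤ : ℕ∞) φ → HasCompactSupport φ →
      ∫ x, ⟪x, φ x⟫ ∂ρ = ∫ x, Matrix.trace (τ x * jacobianM φ x) ∂ρ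

/-! ### A monotone transport map from `N(0,1)` to `(N(a,1) + N(-a,1)) / 2` -/

/-- The distribution function of the standard Gaussian on `ℝ`. -/
def gaussCDF (x : ℝ) : ℝ := (gaussianReal 0 1).real (Set.Iic x)

/-- The distribution function of the symmetric mixture `(N(a,1) + N(-a,1)) / 2`. -/
def mixCDF (a y : ℝ) : ℝ := (gaussCDF (y - a) + gaussCDF (y + a)) / 2

lemma gaussCDF_eq_integral (x : ℝ) :
    gaussCDF x = gaussCDF 0 + ∫ t in (0 : ℝ)..x, gaussianPDFReal 0 1 t := by
  have hI : Integrable (gaussianPDFReal 0 1) := integrable_gaussianPDFReal 0 1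
  have h (y : ℝ) : gaussCDF y = ∫ t in Set.Iic y, gaussianPDFReal 0 1 t := by
    rw [gaussCDF, measureReal_def, gaussianReal_apply_eq_integral 0 one_ne_zero,
      ENNReal.toReal_ofReal (integral_nonneg fun t => gaussianPDFReal_nonneg 0 1 t)]
  rw [← intervalIntegral.integral_Iic_sub_Iic hI.integrableOn hI.integrableOn, h, h]
  ring

lemma hasDerivAt_gaussCDF (x : ℝ) : HasDerivAt gaussCDF (gaussianPDFReal 0 1 x) x := by
  have hc : Continuous (gaussianPDFReal 0 1) := by
    unfold gaussianPDFReal; fun_prop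
  have := (hc.integral_hasStrictDerivAt 0 x).hasDerivAt.const_add (gaussCDF 0)
  exact this.congr_of_eventuallyEq (Filter.Eventually.of_forall gaussCDF_eq_integral)

lemma continuous_gaussCDF : Continuous gaussCDF :=
  continuous_iff_continuousAt.2 fun x => (hasDerivAt_gaussCDF x).continuousAt

lemma strictMono_gaussCDF : StrictMono gaussCDF :=
  strictMono_of_hasDerivAt_pos hasDerivAt_gaussCDF
    fun x => gaussianPDFReal_pos 0 1 x one_ne_zero

lemma gaussCDF_neg (x : ℝ) : gaussCDF (-x) = 1 - gaussCDF x := by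
  have h1 : gaussCDF (-x) = (gaussianReal 0 1).real (Set.Ici x) := by
    have : gaussianReal 0 1 = (gaussianReal 0 1).map (fun x => -x) := by
      rw [gaussianReal_map_neg, neg_zero]
    rw [gaussCDF, this, map_measureReal_apply measurable_neg measurableSet_Iic, ← this]
    congr 1
    ext y; simp
  have h2 : (gaussianReal 0 1).real (Set.Ici x) = (gaussianReal 0 1).real (Set.Ioi x) := by
    have := nullSingletonClass_gaussianReal (μ := 0) (v := 1) one_ne_zero
    exact measureReal_congr Ioi_ae_eq_Ici.symm
  rw [h1, h2, ← Set.compl_Iic, probReal_compl_eq_one_sub measurableSet_Iic, gaussCDF]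

lemma mixCDF_neg (a y : ℝ) : mixCDF a (-y) = 1 - mixCDF a y := by
  have h1 : -y - a = -(y + a) := by ring
  have h2 : -y + a = -(y - a) := by ring
  rw [mixCDF, mixCDF, h1, h2, gaussCDF_neg, gaussCDF_neg]
  ring

lemma mixCDF_abs (a y : ℝ) : mixCDF |a| y = mixCDF a y := by
  rcases abs_choice a with h | h <;> rw [h]
  simp only [mixCDF, sub_neg_eq_add, ← sub_eq_add_neg]
  ring

lemma strictMono_mixCDF (a : ℝ) : StrictMono (mixCDF a) := by
  intro x y hxy
  have h1 := strictMono_gaussCDF (sub_lt_sub_right hxy a)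
  have h2 := strictMono_gaussCDF (add_lt_add_left hxy a)
  unfold mixCDF
  linarith

lemma continuous_mixCDF : Continuous (fun q : ℝ × ℝ => mixCDF q.1 q.2) := by
  have := continuous_gaussCDF
  unfold mixCDF
  fun_prop

lemma mixCDF_le_gaussCDF {a y : ℝ} (ha : 0 ≤ a) (hy : 0 ≤ y) : mixCDF a y ≤ gaussCDF y := by
  have hd (b : ℝ) : HasDerivAt (fun b => mixCDF b y)
      ((gaussianPDFReal 0 1 (y - b) * (-1) + gaussianPDFReal 0 1 (y + b) * 1) / 2) b :=
    (((hasDerivAt_gaussCDF (y - b)).comp b ((hasDerivAt_id b).const_sub y)).add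
      ((hasDerivAt_gaussCDF (y + b)).comp b ((hasDerivAt_id b).const_add y))).div_const 2
  have hanti : AntitoneOn (fun b => mixCDF b y) (Set.Ici 0) := by
    refine antitoneOn_of_hasDerivWithinAt_nonpos (convex_Ici 0)
      (fun b _ => (hd b).continuousAt.continuousWithinAt)
      (fun b _ => (hd b).hasDerivWithinAt) fun b hb => ?_
    rw [interior_Ici] at hb
    have hb : 0 < b := hb
    have : gaussianPDFReal 0 1 (y + b) ≤ gaussianPDFReal 0 1 (y - b) := by
      unfold gaussianPDFReal
      refine mul_le_mul_of_nonneg_left (Real.exp_le_exp.2 ?_) (by positivity)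
      rw [NNReal.coe_one]
      nlinarith
    linarith
  simpa [mixCDF] using hanti (Set.mem_Ici.2 le_rfl) (Set.mem_Ici.2 ha) ha

lemma gaussCDF_le_mixCDF_add {a x : ℝ} (ha : 0 ≤ a) : gaussCDF x ≤ mixCDF a (x + a) := by
  have := strictMono_gaussCDF.monotone (show x ≤ x + a + a by linarith)
  rw [mixCDF, add_sub_cancel_right]
  linarith

lemma sinh_le_mul_cosh {u : ℝ} (hu : 0 ≤ u) : Real.sinh u ≤ u * Real.cosh u := by
  have hd (v : ℝ) : HasDerivAt (fun v => v * Real.cosh v - Real.sinh v)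
      (1 * Real.cosh v + v * Real.sinh v - Real.cosh v) v :=
    ((hasDerivAt_id v).mul (Real.hasDerivAt_cosh v)).sub (Real.hasDerivAt_sinh v)
  have hmono : MonotoneOn (fun v => v * Real.cosh v - Real.sinh v) (Set.Ici 0) := by
    refine monotoneOn_of_hasDerivWithinAt_nonneg (convex_Ici 0)
      (fun b _ => (hd b).continuousAt.continuousWithinAt)
      (fun b _ => (hd b).hasDerivWithinAt) fun b hb => ?_
    rw [interior_Ici] at hb
    have := mul_nonneg (le_of_lt hb) (Real.sinh_nonneg_iff.2 (le_of_lt hb))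
    linarith
  have := hmono (Set.mem_Ici.2 le_rfl) (Set.mem_Ici.2 hu) hu
  simp only [zero_mul, Real.sinh_zero, sub_zero] at this
  linarith

lemma gaussCDF_le_mixCDF_mul_exp {a x : ℝ} (ha : 0 ≤ a) (hx : 0 ≤ x) :
    gaussCDF x ≤ mixCDF a (x * Real.exp (a ^ 2 / 2)) := by
  have he (b : ℝ) : HasDerivAt (fun b => x * Real.exp (b ^ 2 / 2))
      (b * (x * Real.exp (b ^ 2 / 2))) b := by
    have h := ((((hasDerivAt_id b).pow 2).div_const 2).exp).const_mul x
    refine h.congr_deriv ?_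
    simp
    ring
  have hd (b : ℝ) : HasDerivAt (fun b => mixCDF b (x * Real.exp (b ^ 2 / 2)))
      ((gaussianPDFReal 0 1 (x * Real.exp (b ^ 2 / 2) - b) *
          (b * (x * Real.exp (b ^ 2 / 2)) - 1) +
        gaussianPDFReal 0 1 (x * Real.exp (b ^ 2 / 2) + b) *
          (b * (x * Real.exp (b ^ 2 / 2)) + 1)) / 2) b := by
    have h1 : HasDerivAt (fun b => x * Real.exp (b ^ 2 / 2) - b) _ b :=
      (he b).sub (hasDerivAt_id b)
    have h2 : HasDerivAt (fun b => x * Real.exp (b ^ 2 / 2) + b) _ b :=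
      (he b).add (hasDerivAt_id b)
    exact (((hasDerivAt_gaussCDF _).comp b h1).add
      ((hasDerivAt_gaussCDF _).comp b h2)).div_const 2
  have hmono : MonotoneOn (fun b => mixCDF b (x * Real.exp (b ^ 2 / 2))) (Set.Ici 0) := by
    refine monotoneOn_of_hasDerivWithinAt_nonneg (convex_Ici 0)
      (fun b _ => (hd b).continuousAt.continuousWithinAt)
      (fun b _ => (hd b).hasDerivWithinAt) fun b hb => ?_
    rw [interior_Ici] at hb
    have hb : 0 < b := hb
    set y := x * Real.exp (b ^ 2 / 2) with hy
    have hy0 : 0 ≤ y := by positivity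
    have hpdf (s : ℝ) (hs : s ^ 2 = b ^ 2) : gaussianPDFReal 0 1 (y + s) =
        gaussianPDFReal 0 1 y * Real.exp (-b ^ 2 / 2) * Real.exp (-(s * y)) := by
      simp only [gaussianPDFReal, NNReal.coe_one, mul_one, sub_zero]
      rw [mul_assoc, mul_assoc, ← Real.exp_add, ← Real.exp_add]
      congr 2
      rw [add_sq, hs]
      ring
    have h1 := hpdf b rfl
    have h2 := hpdf (-b) (by ring)
    have hc := sinh_le_mul_cosh (mul_nonneg hb.le hy0)
    rw [Real.sinh_eq, Real.cosh_eq] at hc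
    rw [sub_eq_add_neg y b, h1, h2, neg_mul, neg_neg]
    have hp : 0 ≤ gaussianPDFReal 0 1 y * Real.exp (-b ^ 2 / 2) :=
      mul_nonneg (gaussianPDFReal_nonneg 0 1 y) (Real.exp_nonneg _)
    nlinarith [mul_nonneg hp (sub_nonneg.2 hc)]
  simpa [mixCDF] using hmono (Set.mem_Ici.2 le_rfl) (Set.mem_Ici.2 ha) ha

lemma exists_mixCDF_eq_of_nonneg {a s : ℝ} (ha : 0 ≤ a) (hs : 0 ≤ s) :
    ∃ t, mixCDF a t = gaussCDF s ∧ |t - s| ≤ a ∧ |t - s| ≤ |s| * (Real.exp (a ^ 2 / 2) - 1) := by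
  have hc : Continuous (mixCDF a) := continuous_mixCDF.comp (by fun_prop : Continuous (Prod.mk a))
  have he : 1 ≤ Real.exp (a ^ 2 / 2) := Real.one_le_exp (by positivity)
  set b := min (s + a) (s * Real.exp (a ^ 2 / 2)) with hb
  have hsb : s ≤ b := le_min (by linarith) (by nlinarith)
  have hle : gaussCDF s ≤ mixCDF a b := by
    rcases min_choice (s + a) (s * Real.exp (a ^ 2 / 2)) with h | h <;> rw [hb, h]
    · exact gaussCDF_le_mixCDF_add ha
    · exact gaussCDF_le_mixCDF_mul_exp ha hs
  obtain ⟨t, ⟨h1, h2⟩, ht⟩ := intermediate_value_Icc hsb hc.continuousOn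
    ⟨mixCDF_le_gaussCDF ha hs, hle⟩
  refine ⟨t, ht, ?_, ?_⟩ <;> rw [abs_of_nonneg (sub_nonneg.2 h1)]
  · have := h2.trans (min_le_left _ _)
    linarith
  · have := h2.trans (min_le_right _ _)
    rw [abs_of_nonneg hs]
    linarith

lemma exists_mixCDF_eq (a s : ℝ) :
    ∃ t, mixCDF a t = gaussCDF s ∧ |t - s| ≤ a ^ 2 * max 1 |s| := by
  have key : ∃ t, mixCDF |a| t = gaussCDF s ∧ |t - s| ≤ |a| ∧
      |t - s| ≤ |s| * (Real.exp (|a| ^ 2 / 2) - 1) := by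
    rcases le_total 0 s with hs | hs
    · exact exists_mixCDF_eq_of_nonneg (abs_nonneg a) hs
    · obtain ⟨t, ht, h⟩ := exists_mixCDF_eq_of_nonneg (abs_nonneg a) (neg_nonneg.2 hs)
      refine ⟨-t, ?_, ?_⟩
      · rw [mixCDF_neg, ht, gaussCDF_neg]
        ring
      · rwa [show -t - s = -(t - -s) by ring, abs_neg, ← abs_neg s]
  obtain ⟨t, ht, h1, h2⟩ := key
  refine ⟨t, by rwa [mixCDF_abs] at ht, ?_⟩
  rw [sq_abs] at h2
  rcases le_total |a| 1 with ha | ha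
  · have ha2 : a ^ 2 ≤ 1 := (sq_le_one_iff_abs_le_one a).2 ha
    have he : Real.exp (a ^ 2 / 2) - 1 ≤ a ^ 2 := by
      have h3 := Real.abs_exp_sub_one_le (x := a ^ 2 / 2)
        (by rw [abs_of_nonneg (by positivity)]; linarith)
      rw [abs_of_nonneg (by positivity : 0 ≤ a ^ 2 / 2)] at h3
      linarith [le_abs_self (Real.exp (a ^ 2 / 2) - 1)]
    calc |t - s| ≤ |s| * a ^ 2 := h2.trans (by gcongr)
      _ ≤ a ^ 2 * max 1 |s| := by rw [mul_comm]; gcongr; exact le_max_right _ _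
  · calc |t - s| ≤ |a| ^ 2 * 1 := by nlinarith
      _ ≤ a ^ 2 * max 1 |s| := by rw [sq_abs]; gcongr; exact le_max_left _ _

lemma exists_gaussCDF_eq (a y : ℝ) : ∃ s, gaussCDF s = mixCDF a y := by
  have h : y - |a| ≤ y + |a| := by linarith [abs_nonneg a]
  have hm := strictMono_gaussCDF.monotone h
  obtain ⟨s, -, hs⟩ := intermediate_value_Icc h continuous_gaussCDF.continuousOn
    (show mixCDF |a| y ∈ _ from ⟨by unfold mixCDF; linarith, by unfold mixCDF; linarith⟩)
  exact ⟨s, by rw [hs, mixCDF_abs]⟩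

/-- The increasing map transporting `N(0,1)` to `(N(a,1) + N(-a,1)) / 2`. -/
def mixMap (a s : ℝ) : ℝ := (exists_mixCDF_eq a s).choose

lemma mixCDF_mixMap (a s : ℝ) : mixCDF a (mixMap a s) = gaussCDF s :=
  (exists_mixCDF_eq a s).choose_spec.1

lemma abs_mixMap_sub_le (a s : ℝ) : |mixMap a s - s| ≤ a ^ 2 * max 1 |s| :=
  (exists_mixCDF_eq a s).choose_spec.2

lemma mixMap_le_iff (a s y : ℝ) : mixMap a s ≤ y ↔ gaussCDF s ≤ mixCDF a y := by
  rw [← (strictMono_mixCDF a).le_iff_le, mixCDF_mixMap]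

lemma measurable_mixMap : Measurable (fun q : ℝ × ℝ => mixMap q.1 q.2) := by
  refine measurable_of_Iic fun y => ?_
  have hc : Continuous fun q : ℝ × ℝ => mixCDF q.1 y :=
    continuous_mixCDF.comp (by fun_prop : Continuous fun q : ℝ × ℝ => (q.1, y))
  have : (fun q : ℝ × ℝ => mixMap q.1 q.2) ⁻¹' Set.Iic y =
      {q : ℝ × ℝ | gaussCDF q.2 ≤ mixCDF q.1 y} := by
    ext q; exact mixMap_le_iff _ _ _
  rw [this]
  exact measurableSet_le (continuous_gaussCDF.measurable.comp measurable_snd) hc.measurable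

lemma Measurable.mixMap {α : Type*} [MeasurableSpace α] {f g : α → ℝ} (hf : Measurable f)
    (hg : Measurable g) : Measurable fun x => mixMap (f x) (g x) :=
  Measurable.comp (g := fun q : ℝ × ℝ => _root_.mixMap q.1 q.2) (f := fun x => (f x, g x))
    measurable_mixMap (hf.prodMk hg)

lemma measurable_mixMap_right (a : ℝ) : Measurable (mixMap a) :=
  measurable_const.mixMap measurable_id

lemma map_mixMap (a : ℝ) : (gaussianReal 0 1).map (mixMap a) =
    (2⁻¹ : ℝ≥0∞) • ((gaussianReal 0 1).map (fun s => s + a) +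
      (gaussianReal 0 1).map (fun s => s - a)) := by
  have hm := measurable_mixMap_right a
  refine Measure.ext_of_Iic _ _ fun y => ?_
  have hg (x : ℝ) : gaussianReal 0 1 (Set.Iic x) = ENNReal.ofReal (gaussCDF x) :=
    (ofReal_measureReal (measure_ne_top _ _)).symm
  have hnn (x : ℝ) : 0 ≤ gaussCDF x := measureReal_nonneg
  obtain ⟨s, hs⟩ := exists_gaussCDF_eq a y
  have h1 : mixMap a ⁻¹' Set.Iic y = Set.Iic s := by
    ext x
    simp [mixMap_le_iff, ← hs, strictMono_gaussCDF.le_iff_le]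
  have h2 : (fun s => s + a) ⁻¹' Set.Iic y = Set.Iic (y - a) := by
    ext x; simp [le_sub_iff_add_le]
  have h3 : (fun s => s - a) ⁻¹' Set.Iic y = Set.Iic (y + a) := by
    ext x; simp
  rw [Measure.map_apply hm measurableSet_Iic, Measure.smul_apply, Measure.add_apply,
    Measure.map_apply (by fun_prop) measurableSet_Iic,
    Measure.map_apply (by fun_prop) measurableSet_Iic, h1, h2, h3, hg, hg, hg, hs, mixCDF,
    ← ENNReal.ofReal_add (hnn _) (hnn _), div_eq_inv_mul, ENNReal.ofReal_mul (by norm_num),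
    ENNReal.ofReal_inv_of_pos two_pos, ENNReal.ofReal_ofNat, smul_eq_mul]

lemma lintegral_mixMap (a : ℝ) {f : ℝ → ℝ≥0∞} (hf : Measurable f) :
    ∫⁻ s, f (mixMap a s) ∂gaussianReal 0 1 =
      2⁻¹ * (∫⁻ s, f (s + a) ∂gaussianReal 0 1 + ∫⁻ s, f (s - a) ∂gaussianReal 0 1) := by
  rw [← lintegral_map hf (measurable_mixMap_right a), map_mixMap, lintegral_smul_measure,
    lintegral_add_measure, lintegral_map hf (by fun_prop), lintegral_map hf (by fun_prop),
    smul_eq_mul]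

lemma lintegral_abs_mixMap_sub_le (a : ℝ) {p : ℝ} (hp : p = 1 ∨ p = 2) :
    ∫⁻ s, ENNReal.ofReal (|mixMap a s - s| ^ p) ∂gaussianReal 0 1 ≤
      ENNReal.ofReal (3 * |a| ^ (2 * p)) := by
  have hp0 : 0 ≤ p := by rcases hp with rfl | rfl <;> norm_num
  have hb (s : ℝ) : |mixMap a s - s| ^ p ≤ |a| ^ (2 * p) * (2 + s ^ 2) := by
    have h1 : |mixMap a s - s| ^ p ≤ (a ^ 2 * max 1 |s|) ^ p :=
      Real.rpow_le_rpow (abs_nonneg _) (abs_mixMap_sub_le a s) hp0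
    have h2 : (max 1 |s|) ^ p ≤ 2 + s ^ 2 := by
      rcases hp with rfl | rfl
      · rw [Real.rpow_one, ← sq_abs s]
        exact max_le (by nlinarith [sq_nonneg |s|]) (by nlinarith [sq_nonneg (|s| - 1)])
      · rw [Real.rpow_two, ← sq_abs s]
        rcases max_choice 1 |s| with h | h <;> rw [h] <;> nlinarith [sq_nonneg |s|]
    rw [Real.mul_rpow (by positivity) (by positivity), ← sq_abs, ← Real.rpow_two,
      ← Real.rpow_mul (abs_nonneg a)] at h1
    exact h1.trans (by gcongr)
  have hi : Integrable (fun s : ℝ => s ^ 2) (gaussianReal 0 1) :=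
    (memLp_id_gaussianReal 2).integrable_sq
  have hv : ∫ s, s ^ 2 ∂gaussianReal 0 1 = 1 := by
    have := variance_fun_id_gaussianReal (μ := 0) (v := 1)
    rw [variance_eq_integral (by fun_prop)] at this
    simpa using this
  calc _ ≤ ∫⁻ s, ENNReal.ofReal (|a| ^ (2 * p) * (2 + s ^ 2)) ∂gaussianReal 0 1 :=
        lintegral_mono fun s => ENNReal.ofReal_le_ofReal (hb s)
    _ = ENNReal.ofReal (∫ s, |a| ^ (2 * p) * (2 + s ^ 2) ∂gaussianReal 0 1) := by
        rw [ofReal_integral_eq_lintegral_ofReal]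
        · exact ((integrable_const _).add hi).const_mul _
        · exact Filter.Eventually.of_forall fun s => by positivity
    _ = _ := by
        rw [integral_const_mul, integral_add (integrable_const _) hi, hv]
        simp only [integral_const, probReal_univ, smul_eq_mul]
        congr 1
        ring

/-! ### Replacing one coordinate of a standard Gaussian vector -/

section Line

variable {E : Type*} [NormedAddCommGroup E] [InnerProductSpace ℝ E] [FiniteDimensional ℝ E]
  [MeasurableSpace E] [BorelSpace E]

lemma map_replace_line_stdGaussian {u : E} (hu : u = 0 ∨ ‖u‖ = 1) :
    ((ProbabilityTheory.stdGaussian E).prod (gaussianReal 0 1)).map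
      (fun q : E × ℝ => q.1 - ⟪u, q.1⟫ • u + q.2 • u) = ProbabilityTheory.stdGaussian E := by
  have hm : Measurable (fun q : E × ℝ => q.1 - ⟪u, q.1⟫ • u + q.2 • u) := by fun_prop
  have : IsProbabilityMeasure (((ProbabilityTheory.stdGaussian E).prod (gaussianReal 0 1)).map
      (fun q : E × ℝ => q.1 - ⟪u, q.1⟫ • u + q.2 • u)) :=
    Measure.isProbabilityMeasure_map hm.aemeasurable
  refine Measure.ext_of_charFun (funext fun t => ?_)
  have hsplit (q : E × ℝ) :
      Complex.exp (⟪q.1 - ⟪u, q.1⟫ • u + q.2 • u, t⟫ * Complex.I) =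
        Complex.exp (⟪q.1, t - ⟪u, t⟫ • u⟫ * Complex.I) *
          Complex.exp (⟪q.2, ⟪u, t⟫⟫ * Complex.I) := by
    rw [← Complex.exp_add, ← add_mul, ← Complex.ofReal_add]
    congr 3
    simp only [inner_add_left, inner_sub_left, inner_sub_right, real_inner_smul_left,
      real_inner_smul_right, real_inner_comm u q.1, RCLike.inner_apply, conj_trivial]
    ring
  rw [charFun_apply, integral_map hm.aemeasurable (by fun_prop)]
  simp_rw [hsplit]
  rw [integral_prod_mul (fun z : E => Complex.exp (⟪z, t - ⟪u, t⟫ • u⟫ * Complex.I))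
    (fun s : ℝ => Complex.exp (⟪s, ⟪u, t⟫⟫ * Complex.I)), ← charFun_apply, ← charFun_apply,
    charFun_stdGaussian, charFun_stdGaussian, charFun_gaussianReal, ← Complex.exp_add]
  congr 1
  have hn : ‖t - ⟪u, t⟫ • u‖ ^ 2 + ⟪u, t⟫ ^ 2 = ‖t‖ ^ 2 := by
    rcases hu with rfl | hu
    · simp
    · rw [norm_sub_sq_real, real_inner_smul_right, norm_smul, mul_pow, hu, Real.norm_eq_abs,
        sq_abs, real_inner_comm]
      ring
  rw [← Complex.ofReal_pow ‖t‖, ← hn]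
  push_cast
  ring

/-- Replace the component of `z` along `v` by `s` times the unit vector in the direction `v`. -/
def replaceLine (v z : E) (s : ℝ) : E := z - ⟪‖v‖⁻¹ • v, z⟫ • (‖v‖⁻¹ • v) + s • (‖v‖⁻¹ • v)

lemma Measurable.replaceLine {α : Type*} [MeasurableSpace α] {v z : α → E} {s : α → ℝ}
    (hv : Measurable v) (hz : Measurable z) (hs : Measurable s) :
    Measurable fun x => replaceLine (v x) (z x) (s x) := by
  unfold _root_.replaceLine
  fun_prop

lemma lintegral_replaceLine (v : E) {f : E → ℝ≥0∞} (hf : Measurable f) :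
    ∫⁻ z, ∫⁻ s, f (replaceLine v z s) ∂gaussianReal 0 1 ∂ProbabilityTheory.stdGaussian E =
      ∫⁻ z, f z ∂ProbabilityTheory.stdGaussian E := by
  have hu : ‖v‖⁻¹ • v = 0 ∨ ‖‖v‖⁻¹ • v‖ = 1 := by
    rcases eq_or_ne v 0 with rfl | hv
    · simp
    · exact Or.inr (norm_smul_inv_norm (𝕜 := ℝ) hv)
  have hm : Measurable (fun q : E × ℝ => replaceLine v q.1 q.2) := by
    unfold replaceLine; fun_prop
  conv_rhs => rw [← map_replace_line_stdGaussian hu]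
  rw [lintegral_map hf (by fun_prop), lintegral_prod _ (by fun_prop)]
  rfl

lemma lintegral_replaceLine_mixMap (v : E) {f : E → ℝ≥0∞} (hf : Measurable f) :
    ∫⁻ z, ∫⁻ s, f (replaceLine v z (mixMap ‖v‖ s)) ∂gaussianReal 0 1
        ∂ProbabilityTheory.stdGaussian E =
      2⁻¹ * (∫⁻ z, f (z + v) ∂ProbabilityTheory.stdGaussian E +
        ∫⁻ z, f (z - v) ∂ProbabilityTheory.stdGaussian E) := by
  have hv : ‖v‖ • ‖v‖⁻¹ • v = v := by
    rcases eq_or_ne v 0 with rfl | hv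
    · simp
    · rw [smul_smul, mul_inv_cancel₀ (norm_ne_zero_iff.2 hv), one_smul]
  have hm (z : E) : Measurable (replaceLine v z) := by
    unfold replaceLine; fun_prop
  have hadd (z : E) (s : ℝ) : replaceLine v z (s + ‖v‖) = replaceLine v z s + v := by
    rw [replaceLine, add_smul, hv, replaceLine, add_assoc]
  have hsub (z : E) (s : ℝ) : replaceLine v z (s - ‖v‖) = replaceLine v z s - v := by
    rw [replaceLine, sub_smul, hv, replaceLine, add_sub_assoc]
  have hm' : Measurable (fun q : E × ℝ => f (replaceLine v q.1 q.2 + v)) :=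
    hf.comp (by unfold replaceLine; fun_prop)
  have hz (z : E) : ∫⁻ s, f (replaceLine v z (mixMap ‖v‖ s)) ∂gaussianReal 0 1 =
      2⁻¹ * (∫⁻ s, f (replaceLine v z s + v) ∂gaussianReal 0 1 +
        ∫⁻ s, f (replaceLine v z s - v) ∂gaussianReal 0 1) := by
    rw [lintegral_mixMap ‖v‖ (f := fun s => f (replaceLine v z s)) (hf.comp (hm z))]
    simp_rw [hadd, hsub]
  simp_rw [hz]
  rw [lintegral_const_mul' _ _ (by simp), lintegral_add_left hm'.lintegral_prod_right',
    lintegral_replaceLine v (f := fun z => f (z + v)) (by fun_prop),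
    lintegral_replaceLine v (f := fun z => f (z - v)) (by fun_prop)]

omit [FiniteDimensional ℝ E] [MeasurableSpace E] [BorelSpace E] in
lemma norm_replaceLine_sub_le (v z : E) (s t : ℝ) :
    ‖replaceLine v z s - replaceLine v z t‖ ≤ |s - t| := by
  have hu : ‖‖v‖⁻¹ • v‖ ≤ 1 := by
    rw [norm_smul, norm_inv, norm_norm]
    exact inv_mul_le_one
  rw [replaceLine, replaceLine, add_sub_add_left_eq_sub, ← sub_smul, norm_smul, Real.norm_eq_abs]
  exact mul_le_of_le_one_right (abs_nonneg _) hu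

/-! ### Couplings -/

lemma exists_coupling_trans {μ ν ρ : Measure E} {τ₁ τ₂ : Measure (E × E)}
    [IsProbabilityMeasure τ₁] [IsProbabilityMeasure τ₂]
    (h₁ : τ₁ ∈ couplings μ ν) (h₂ : τ₂ ∈ couplings ν ρ) {p : ℝ} (hp : 1 ≤ p) :
    ∃ τ ∈ couplings μ ρ, (∫⁻ z, ENNReal.ofReal (‖z.1 - z.2‖ ^ p) ∂τ) ^ (1 / p) ≤
      (∫⁻ z, ENNReal.ofReal (‖z.1 - z.2‖ ^ p) ∂τ₁) ^ (1 / p) +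
        (∫⁻ z, ENNReal.ofReal (‖z.1 - z.2‖ ^ p) ∂τ₂) ^ (1 / p) := by
  have hp0 : 0 ≤ p := by linarith
  set κ := τ₂.condKernel.comap (Prod.snd : E × E → E) measurable_snd
  set σ := τ₁ ⊗ₘ κ with hσ
  have hσ₁ : σ.map Prod.fst = τ₁ := Measure.fst_compProd τ₁ κ
  have hσ₂ : σ.map (fun q : (E × E) × E => (q.1.2, q.2)) = τ₂ := by
    refine Measure.ext_of_lintegral _ fun f hf => ?_
    have hm : Measurable fun y => ∫⁻ w, f (y, w) ∂τ₂.condKernel y :=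
      hf.lintegral_kernel_prod_right'
    rw [lintegral_map hf (by fun_prop), Measure.lintegral_compProd (by fun_prop),
      ← Measure.lintegral_condKernel hf, Measure.fst, h₂.1, ← h₁.2, lintegral_map hm measurable_snd]
    rfl
  have hof (x : E) : ENNReal.ofReal (‖x‖ ^ p) = ‖x‖ₑ ^ p := by
    rw [← ENNReal.ofReal_rpow_of_nonneg (norm_nonneg x) hp0, ofReal_norm]
  have hmeas : Measurable fun z : E × E => ‖z.1 - z.2‖ₑ ^ p := by fun_prop
  refine ⟨σ.map (fun q : (E × E) × E => (q.1.1, q.2)), ⟨?_, ?_⟩, ?_⟩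
  · rw [Measure.map_map measurable_fst (by fun_prop), ← h₁.1, ← hσ₁,
      Measure.map_map measurable_fst measurable_fst]
    rfl
  · rw [Measure.map_map measurable_snd (by fun_prop), ← h₂.2, ← hσ₂,
      Measure.map_map measurable_snd (by fun_prop)]
    rfl
  · simp_rw [hof]
    rw [lintegral_map hmeas (by fun_prop)]
    conv_rhs => rw [← hσ₁, ← hσ₂]
    rw [lintegral_map hmeas (by fun_prop), lintegral_map hmeas (by fun_prop)]
    refine le_trans (ENNReal.rpow_le_rpow (lintegral_mono fun q => ?_) (by positivity))
      (ENNReal.lintegral_Lp_add_le (f := fun q : (E × E) × E => ‖q.1.1 - q.1.2‖ₑ)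
        (g := fun q : (E × E) × E => ‖q.1.2 - q.2‖ₑ) (by fun_prop) (by fun_prop) hp)
    refine ENNReal.rpow_le_rpow ?_ hp0
    calc ‖q.1.1 - q.2‖ₑ = ‖(q.1.1 - q.1.2) + (q.1.2 - q.2)‖ₑ := by rw [sub_add_sub_cancel]
      _ ≤ _ := enorm_add_le _ _

omit [NormedAddCommGroup E] [InnerProductSpace ℝ E] [FiniteDimensional ℝ E] [BorelSpace E] in
lemma isProbabilityMeasure_of_mem_couplings {μ ν : Measure E} [IsProbabilityMeasure μ]
    {τ : Measure (E × E)} (h : τ ∈ couplings μ ν) : IsProbabilityMeasure τ := by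
  refine ⟨?_⟩
  have := congrArg (fun m : Measure E => m Set.univ) h.1
  simpa [Measure.map_apply measurable_fst MeasurableSet.univ] using this

lemma exists_coupling_conv_self (μ γ : Measure E) [IsProbabilityMeasure μ]
    [IsProbabilityMeasure γ] (p : ℝ) :
    ∃ τ ∈ couplings (μ ∗ γ) γ, ∫⁻ z, ENNReal.ofReal (‖z.1 - z.2‖ ^ p) ∂τ =
      ∫⁻ x, ENNReal.ofReal (‖x‖ ^ p) ∂μ := by
  refine ⟨(μ.prod γ).map (fun q => (q.1 + q.2, q.2)), ⟨?_, ?_⟩, ?_⟩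
  · rw [Measure.map_map measurable_fst (by fun_prop)]
    rfl
  · rw [Measure.map_map measurable_snd (by fun_prop)]
    exact Measure.snd_prod
  · rw [lintegral_map (by fun_prop) (by fun_prop)]
    simp only [add_sub_cancel_right]
    rw [lintegral_prod _ (by fun_prop)]
    simp

/-- The law of the average of two independent copies. -/
def halfSum (μ : Measure E) : Measure E := (μ.prod μ).map fun q => (2⁻¹ : ℝ) • (q.1 + q.2)

instance isProbabilityMeasure_halfSum (μ : Measure E) [IsProbabilityMeasure μ] :
    IsProbabilityMeasure (halfSum μ) :=
  Measure.isProbabilityMeasure_map (by fun_prop)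

lemma exists_coupling_halfSum (μ : Measure E) [IsProbabilityMeasure μ] {p : ℝ}
    (hp : p = 1 ∨ p = 2) :
    ∃ τ ∈ couplings (μ ∗ ProbabilityTheory.stdGaussian E)
        (halfSum μ ∗ ProbabilityTheory.stdGaussian E),
      ∫⁻ z, ENNReal.ofReal (‖z.1 - z.2‖ ^ p) ∂τ ≤
        ∫⁻ q, ENNReal.ofReal (3 * ‖(2⁻¹ : ℝ) • (q.1 - q.2)‖ ^ (2 * p)) ∂(μ.prod μ) := by
  have hp0 : 0 ≤ p := by rcases hp with rfl | rfl <;> norm_num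
  set γ := ProbabilityTheory.stdGaussian E
  let m : E × E → E := fun q => (2⁻¹ : ℝ) • (q.1 + q.2)
  let v : E × E → E := fun q => (2⁻¹ : ℝ) • (q.1 - q.2)
  have hmm : Measurable m := by fun_prop
  have hvm : Measurable v := by fun_prop
  let Y : (E × E) × E × ℝ → E := fun q => m q.1 + replaceLine (v q.1) q.2.1 q.2.2
  let X : (E × E) × E × ℝ → E :=
    fun q => m q.1 + replaceLine (v q.1) q.2.1 (mixMap ‖v q.1‖ q.2.2)
  have hv1 : Measurable fun q : (E × E) × E × ℝ => v q.1 := hvm.comp measurable_fst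
  have hm1 : Measurable fun q : (E × E) × E × ℝ => m q.1 := hmm.comp measurable_fst
  have hY : Measurable Y :=
    hm1.add (hv1.replaceLine measurable_snd.fst measurable_snd.snd)
  have hX : Measurable X :=
    hm1.add (hv1.replaceLine measurable_snd.fst (hv1.norm.mixMap measurable_snd.snd))
  refine ⟨((μ.prod μ).prod (γ.prod (gaussianReal 0 1))).map fun q => (X q, Y q),
    ⟨?_, ?_⟩, ?_⟩
  · rw [Measure.map_map measurable_fst (hX.prodMk hY)]
    refine Measure.ext_of_lintegral _ fun f hf => ?_
    rw [lintegral_map hf (measurable_fst.comp (hX.prodMk hY)),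
      lintegral_prod _ (by fun_prop)]
    have hinner (q : E × E) : ∫⁻ w, f ((Prod.fst ∘ fun q => (X q, Y q)) (q, w))
        ∂(γ.prod (gaussianReal 0 1)) =
        2⁻¹ * (∫⁻ z, f (q.1 + z) ∂γ + ∫⁻ z, f (q.2 + z) ∂γ) := by
      have h1 : m q + v q = q.1 := by
        simp only [m, v]
        module
      have h2 : m q - v q = q.2 := by
        simp only [m, v]
        module
      have := lintegral_replaceLine_mixMap (v q) (f := fun z => f (m q + z)) (by fun_prop)
      rw [lintegral_prod _ (by fun_prop)]
      refine this.trans ?_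
      congr 2
      · refine lintegral_congr fun z => ?_
        rw [← h1]; congr 1; abel
      · refine lintegral_congr fun z => ?_
        rw [← h2]; congr 1; abel
    simp_rw [hinner]
    have hfm : Measurable fun q : E × E => f (q.1 + q.2) := by fun_prop
    have hg : Measurable fun x : E => ∫⁻ z, f (x + z) ∂γ := hfm.lintegral_prod_right'
    have hg1 : Measurable fun q : E × E => ∫⁻ z, f (q.1 + z) ∂γ := hg.comp measurable_fst
    have hg2 : Measurable fun q : E × E => ∫⁻ z, f (q.2 + z) ∂γ := hg.comp measurable_snd
    rw [lintegral_const_mul' _ _ (by simp), lintegral_add_left hg1,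
      lintegral_prod _ hg1.aemeasurable, lintegral_prod _ hg2.aemeasurable,
      Measure.lintegral_conv hf]
    simp only [lintegral_const, measure_univ, mul_one, ← two_mul]
    rw [← mul_assoc, ENNReal.inv_mul_cancel two_ne_zero ENNReal.ofNat_ne_top, one_mul]
  · rw [Measure.map_map measurable_snd (hX.prodMk hY)]
    refine Measure.ext_of_lintegral _ fun f hf => ?_
    have hfm : Measurable fun q : E × E => f (q.1 + q.2) := by fun_prop
    rw [lintegral_map hf (measurable_snd.comp (hX.prodMk hY)),
      lintegral_prod _ (by fun_prop), Measure.lintegral_conv hf, halfSum,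
      lintegral_map hfm.lintegral_prod_right' hmm]
    refine lintegral_congr fun q => ?_
    rw [lintegral_prod _ (by fun_prop)]
    exact lintegral_replaceLine (v q) (f := fun z => f (m q + z)) (by fun_prop)
  · rw [lintegral_map (by fun_prop) (hX.prodMk hY), lintegral_prod _ (by fun_prop)]
    refine lintegral_mono fun q => ?_
    rw [lintegral_prod _ (by fun_prop)]
    calc _ ≤ ∫⁻ _, ∫⁻ s, ENNReal.ofReal (|mixMap ‖v q‖ s - s| ^ p) ∂gaussianReal 0 1 ∂γ := by
          refine lintegral_mono fun z => lintegral_mono fun s => ENNReal.ofReal_le_ofReal ?_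
          refine Real.rpow_le_rpow (norm_nonneg _) ?_ hp0
          simp only [X, Y, add_sub_add_left_eq_sub]
          exact norm_replaceLine_sub_le _ _ _ _
      _ ≤ ENNReal.ofReal (3 * |‖v q‖| ^ (2 * p)) := by
          rw [lintegral_const, measure_univ, mul_one]
          exact lintegral_abs_mixMap_sub_le _ hp
      _ = _ := by rw [abs_norm]

/-! ### Moments of half-sums -/

/-- The vector field `x ↦ ‖x‖ ^ (2 * p - 2) x / 4`. -/
def powField (p : ℝ) (x : E) : E := (1 / 4 * ‖x‖ ^ (2 * p - 2)) • x

omit [FiniteDimensional ℝ E] [MeasurableSpace E] [BorelSpace E] in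
lemma norm_half_add_rpow_le (a b : E) {σ p : ℝ} (hσ : σ ^ 2 = 1) (hp : p = 1 ∨ p = 2) :
    ‖(2⁻¹ : ℝ) • (a + σ • b)‖ ^ (2 * p) ≤
      1 / 4 * (‖a‖ ^ (2 * p) + ‖b‖ ^ (2 * p)) +
        σ * (⟪powField p a, b⟫ + ⟪a, powField p b⟫) := by
  have hsq : ‖(2⁻¹ : ℝ) • (a + σ • b)‖ ^ 2 =
      1 / 4 * (‖a‖ ^ 2 + 2 * (σ * ⟪a, b⟫) + ‖b‖ ^ 2) := by
    rw [norm_smul, mul_pow, norm_add_sq_real, real_inner_smul_right, norm_smul, mul_pow,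
      Real.norm_eq_abs σ, sq_abs, hσ]
    norm_num
  simp only [powField, real_inner_smul_left, real_inner_smul_right]
  rcases hp with rfl | rfl
  · have h2 (x : ℝ) : x ^ ((2 : ℝ) * 1) = x ^ 2 := by
      rw [← Real.rpow_natCast]
      norm_num
    have h0 (x : ℝ) : x ^ ((2 : ℝ) * 1 - 2) = 1 := by norm_num
    simp only [h2, h0, hsq]
    linarith
  · have h4 (x : ℝ) : x ^ ((2 : ℝ) * 2) = (x ^ 2) ^ 2 := by
      rw [← pow_mul, ← Real.rpow_natCast]
      norm_num
    have h2 (x : ℝ) : x ^ ((2 : ℝ) * 2 - 2) = x ^ 2 := by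
      rw [← Real.rpow_natCast]
      norm_num
    simp only [h4, h2, hsq]
    have hin : (σ * ⟪a, b⟫) ^ 2 ≤ ‖a‖ ^ 2 * ‖b‖ ^ 2 := by
      rw [mul_pow, hσ, one_mul, ← mul_pow]
      exact sq_le_sq' (by linarith [abs_le.1 (abs_real_inner_le_norm a b)])
        (real_inner_le_norm a b)
    nlinarith [sq_nonneg (‖a‖ ^ 2 - ‖b‖ ^ 2)]

omit [InnerProductSpace ℝ E] [FiniteDimensional ℝ E] [BorelSpace E] in
lemma integrable_of_norm_rpow_le {μ : Measure E} [IsFiniteMeasure μ] {p : ℝ}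
    (hμ : Integrable (fun x => ‖x‖ ^ (2 * p)) μ) {f : E → ℝ} (hf : Measurable f) {q : ℝ}
    (hq : 0 ≤ q) (hqp : q ≤ 2 * p) (hb : ∀ x, |f x| ≤ ‖x‖ ^ q) : Integrable f μ := by
  refine ((integrable_const (1 : ℝ)).add hμ).mono' hf.aestronglyMeasurable
    (Filter.Eventually.of_forall fun x => (hb x).trans ?_)
  simp only [Pi.add_apply]
  rcases le_total ‖x‖ 1 with h | h
  · have := Real.rpow_le_one (norm_nonneg x) h hq
    have := Real.rpow_nonneg (norm_nonneg x) (2 * p)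
    linarith
  · have := Real.rpow_le_rpow_of_exponent_le h hqp
    linarith

lemma integral_norm_half_add_le {μ : Measure E} [IsProbabilityMeasure μ] {σ p : ℝ}
    (hσ : σ ^ 2 = 1) (hp : p = 1 ∨ p = 2) (hμ : Integrable (fun x => ‖x‖ ^ (2 * p)) μ)
    (hc : ∫ x, x ∂μ = 0) :
    Integrable (fun q : E × E => ‖(2⁻¹ : ℝ) • (q.1 + σ • q.2)‖ ^ (2 * p)) (μ.prod μ) ∧
    ∫ q : E × E, ‖(2⁻¹ : ℝ) • (q.1 + σ • q.2)‖ ^ (2 * p) ∂(μ.prod μ) ≤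
      (∫ x, ‖x‖ ^ (2 * p) ∂μ) / 2 := by
  have hp1 : 1 ≤ p := by rcases hp with rfl | rfl <;> norm_num
  have hLm : Measurable (powField p : E → E) := by unfold powField; fun_prop
  have hid : Integrable (fun x : E => ‖x‖) μ :=
    integrable_of_norm_rpow_le hμ measurable_norm zero_le_one (by linarith) fun x => by simp
  have hid' : Integrable (fun x : E => x) μ :=
    (integrable_norm_iff measurable_id.aestronglyMeasurable).1 hid
  have hL : Integrable (fun x : E => ‖powField p x‖) μ := by
    refine integrable_of_norm_rpow_le hμ hLm.norm (q := 2 * p - 1) (by linarith) (by linarith)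
      fun x => ?_
    have h1 : ‖x‖ ^ (2 * p - 1) = ‖x‖ ^ (2 * p - 2) * ‖x‖ := by
      rcases eq_or_ne x 0 with rfl | hx
      · rw [norm_zero, Real.zero_rpow (by linarith), mul_zero]
      · rw [← Real.rpow_add_one (norm_ne_zero_iff.2 hx)]
        congr 1
        ring
    have h2 : 0 ≤ ‖x‖ ^ (2 * p - 2) := by positivity
    rw [abs_norm, powField, norm_smul, h1, Real.norm_eq_abs, abs_of_nonneg (by positivity)]
    gcongr
    linarith
  have hi1 : Integrable (fun q : E × E => ⟪powField p q.1, q.2⟫) (μ.prod μ) :=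
    (hL.mul_prod hid).mono' (by fun_prop)
      (Filter.Eventually.of_forall fun q => norm_inner_le_norm _ _)
  have hi2 : Integrable (fun q : E × E => ⟪q.1, powField p q.2⟫) (μ.prod μ) :=
    (hid.mul_prod hL).mono' (by fun_prop)
      (Filter.Eventually.of_forall fun q => norm_inner_le_norm _ _)
  have hz1 : ∫ q : E × E, ⟪powField p q.1, q.2⟫ ∂(μ.prod μ) = 0 := by
    rw [integral_prod _ hi1]
    simp [integral_inner hid', hc]
  have hz2 : ∫ q : E × E, ⟪q.1, powField p q.2⟫ ∂(μ.prod μ) = 0 := by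
    rw [integral_prod_symm _ hi2]
    simp_rw [real_inner_comm (powField p _)]
    simp [integral_inner hid', hc]
  have hn1 : Integrable (fun q : E × E => ‖q.1‖ ^ (2 * p)) (μ.prod μ) := hμ.comp_fst μ
  have hn2 : Integrable (fun q : E × E => ‖q.2‖ ^ (2 * p)) (μ.prod μ) := hμ.comp_snd μ
  have hA := (hn1.add hn2).const_mul (1 / 4)
  have hB := (hi1.add hi2).const_mul σ
  have hle := fun q : E × E => norm_half_add_rpow_le q.1 q.2 hσ hp
  have hint : Integrable (fun q : E × E => ‖(2⁻¹ : ℝ) • (q.1 + σ • q.2)‖ ^ (2 * p))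
      (μ.prod μ) := by
    refine (hA.add hB).mono' (Measurable.aestronglyMeasurable (by fun_prop))
      (Filter.Eventually.of_forall fun q => ?_)
    rw [Real.norm_of_nonneg (by positivity)]
    exact hle q
  refine ⟨hint, (integral_mono hint (hA.add hB) hle).trans_eq ?_⟩
  have he1 : ∫ q : E × E, ‖q.1‖ ^ (2 * p) ∂(μ.prod μ) = ∫ x, ‖x‖ ^ (2 * p) ∂μ := by
    rw [integral_fun_fst (fun x : E => ‖x‖ ^ (2 * p))]; simp
  have he2 : ∫ q : E × E, ‖q.2‖ ^ (2 * p) ∂(μ.prod μ) = ∫ x, ‖x‖ ^ (2 * p) ∂μ := by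
    rw [integral_fun_snd (fun x : E => ‖x‖ ^ (2 * p))]; simp
  simp only [Pi.add_apply] at hA hB ⊢
  rw [integral_add hA hB, integral_const_mul, integral_const_mul, integral_add hn1 hn2,
    integral_add hi1 hi2, hz1, hz2, he1, he2]
  ring

lemma halfSum_moment {μ : Measure E} [IsProbabilityMeasure μ] {p : ℝ} (hp : p = 1 ∨ p = 2)
    (hμ : Integrable (fun x => ‖x‖ ^ (2 * p)) μ) (hc : ∫ x, x ∂μ = 0) :
    Integrable (fun x => ‖x‖ ^ (2 * p)) (halfSum μ) ∧ ∫ x, x ∂(halfSum μ) = 0 ∧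
      ∫ x, ‖x‖ ^ (2 * p) ∂(halfSum μ) ≤ (∫ x, ‖x‖ ^ (2 * p) ∂μ) / 2 := by
  have hp1 : 1 ≤ p := by rcases hp with rfl | rfl <;> norm_num
  have hm : AEMeasurable (fun q : E × E => (2⁻¹ : ℝ) • (q.1 + q.2)) (μ.prod μ) := by fun_prop
  obtain ⟨h1, h2⟩ := integral_norm_half_add_le (one_pow 2) hp hμ hc
  simp only [one_smul] at h1 h2
  have hid : Integrable (fun x : E => x) μ :=
    (integrable_norm_iff measurable_id.aestronglyMeasurable).1
      (integrable_of_norm_rpow_le hμ measurable_norm zero_le_one (by linarith) fun x => by simp)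
  refine ⟨?_, ?_, ?_⟩
  · exact (integrable_map_measure (Measurable.aestronglyMeasurable (by fun_prop)) hm).2 h1
  · rw [halfSum, integral_map hm (by fun_prop), integral_smul,
      integral_add (hid.comp_fst μ) (hid.comp_snd μ), integral_fun_fst (fun x : E => x),
      integral_fun_snd (fun x : E => x), hc]
    simp
  · rwa [halfSum, integral_map hm (Measurable.aestronglyMeasurable (by fun_prop))]

lemma exists_coupling_halfSum_moment {μ : Measure E} [IsProbabilityMeasure μ] {p : ℝ}
    (hp : p = 1 ∨ p = 2) (hμ : Integrable (fun x => ‖x‖ ^ (2 * p)) μ) (hc : ∫ x, x ∂μ = 0) :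
    ∃ τ ∈ couplings (μ ∗ ProbabilityTheory.stdGaussian E)
        (halfSum μ ∗ ProbabilityTheory.stdGaussian E),
      ∫⁻ z, ENNReal.ofReal (‖z.1 - z.2‖ ^ p) ∂τ ≤
        ENNReal.ofReal (3 / 2 * ∫ x, ‖x‖ ^ (2 * p) ∂μ) := by
  obtain ⟨τ, hτ, hle⟩ := exists_coupling_halfSum μ hp
  obtain ⟨h1, h2⟩ := integral_norm_half_add_le (σ := -1) (by norm_num) hp hμ hc
  simp only [neg_smul, one_smul, ← sub_eq_add_neg] at h1 h2
  refine ⟨τ, hτ, hle.trans ?_⟩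
  rw [← ofReal_integral_eq_lintegral_ofReal (h1.const_mul 3)
    (Filter.Eventually.of_forall fun q => by positivity), integral_const_mul]
  exact ENNReal.ofReal_le_ofReal (by linarith)

/-! ### Iterating half-sums -/

lemma exists_coupling_conv_self_moment {μ : Measure E} [IsProbabilityMeasure μ] {p : ℝ}
    (hp : 1 ≤ p) (hμ : Integrable (fun x => ‖x‖ ^ (2 * p)) μ) :
    ∃ τ ∈ couplings (μ ∗ ProbabilityTheory.stdGaussian E) (ProbabilityTheory.stdGaussian E),
      ∫⁻ z, ENNReal.ofReal (‖z.1 - z.2‖ ^ p) ∂τ ≤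
        ENNReal.ofReal ((∫ x, ‖x‖ ^ (2 * p) ∂μ) ^ (1 / 2 : ℝ)) := by
  obtain ⟨τ, hτ, he⟩ := exists_coupling_conv_self μ (ProbabilityTheory.stdGaussian E) p
  refine ⟨τ, hτ, he.trans_le ?_⟩
  have hi : Integrable (fun x : E => ‖x‖ ^ p) μ :=
    integrable_of_norm_rpow_le hμ (by fun_prop) (by linarith) (by linarith : p ≤ 2 * p)
      fun x => (abs_of_nonneg (by positivity)).le
  have hsq : (fun x : E => (‖x‖ ^ p) ^ 2) = fun x => ‖x‖ ^ (2 * p) := by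
    funext x
    rw [← Real.rpow_natCast, ← Real.rpow_mul (norm_nonneg x), mul_comm]
    norm_num
  have hL2 : MemLp (fun x : E => ‖x‖ ^ p) 2 μ :=
    (memLp_two_iff_integrable_sq (Measurable.aestronglyMeasurable (by fun_prop))).2 (by rwa [hsq])
  have hv := variance_nonneg (fun x : E => ‖x‖ ^ p) μ
  rw [variance_eq_sub hL2] at hv
  rw [← ofReal_integral_eq_lintegral_ofReal hi (Filter.Eventually.of_forall fun x => by positivity)]
  refine ENNReal.ofReal_le_ofReal ?_
  rw [← Real.sqrt_eq_rpow]
  refine Real.le_sqrt_of_sq_le ?_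
  rw [← hsq]
  simpa using hv

lemma exists_coupling_conv_le {p c : ℝ} (hp : p = 1 ∨ p = 2) (hc0 : 0 ≤ c)
    (hc : (3 / 2 : ℝ) ^ (1 / p) + c * (1 / 2 : ℝ) ^ (1 / p) ≤ c) (n : ℕ) {M : ℝ} (hM : 0 ≤ M)
    (μ : Measure E) [IsProbabilityMeasure μ] (hμ : Integrable (fun x => ‖x‖ ^ (2 * p)) μ)
    (hcent : ∫ x, x ∂μ = 0) (hμM : ∫ x, ‖x‖ ^ (2 * p) ∂μ ≤ M) :
    ∃ τ ∈ couplings (μ ∗ ProbabilityTheory.stdGaussian E) (ProbabilityTheory.stdGaussian E),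
      (∫⁻ z, ENNReal.ofReal (‖z.1 - z.2‖ ^ p) ∂τ) ^ (1 / p) ≤
        ENNReal.ofReal (c * M ^ (1 / p) + ((M * (1 / 2) ^ n) ^ (1 / 2 : ℝ)) ^ (1 / p)) := by
  have hp1 : 1 ≤ p := by rcases hp with rfl | rfl <;> norm_num
  have hip : 0 ≤ 1 / p := by positivity
  have hroot {x : ℝ≥0∞} {y : ℝ} (hy : 0 ≤ y) (hxy : x ≤ ENNReal.ofReal y) :
      x ^ (1 / p) ≤ ENNReal.ofReal (y ^ (1 / p)) := by
    rw [← ENNReal.ofReal_rpow_of_nonneg hy hip]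
    exact ENNReal.rpow_le_rpow hxy hip
  have hμ0 : 0 ≤ ∫ x, ‖x‖ ^ (2 * p) ∂μ := integral_nonneg fun x => by positivity
  induction n generalizing M μ with
  | zero =>
    obtain ⟨τ, hτ, hle⟩ := exists_coupling_conv_self_moment hp1 hμ
    refine ⟨τ, hτ, (hroot (by positivity) hle).trans (ENNReal.ofReal_le_ofReal ?_)⟩
    rw [pow_zero, mul_one]
    have : 0 ≤ c * M ^ (1 / p) := by positivity
    refine le_add_of_nonneg_of_le this ?_
    gcongr
  | succ n ih =>
    obtain ⟨h1, h2, h3⟩ := halfSum_moment hp hμ hcent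
    obtain ⟨τ₁, hτ₁, hle₁⟩ := exists_coupling_halfSum_moment hp hμ hcent
    obtain ⟨τ₂, hτ₂, hle₂⟩ := ih (M := M / 2) (by positivity) (halfSum μ) h1 h2
      (h3.trans (by linarith)) (integral_nonneg fun x => by positivity)
    have := isProbabilityMeasure_of_mem_couplings hτ₁
    have := isProbabilityMeasure_of_mem_couplings hτ₂
    obtain ⟨τ, hτ, hle⟩ := exists_coupling_trans hτ₁ hτ₂ hp1
    refine ⟨τ, hτ, hle.trans ((add_le_add (hroot (by positivity) hle₁) hle₂).trans ?_)⟩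
    rw [← ENNReal.ofReal_add (by positivity) (by positivity)]
    refine ENNReal.ofReal_le_ofReal ?_
    have e1 : (3 / 2 * ∫ x, ‖x‖ ^ (2 * p) ∂μ) ^ (1 / p) ≤
        (3 / 2 : ℝ) ^ (1 / p) * M ^ (1 / p) := by
      rw [← Real.mul_rpow (by norm_num) hM]
      gcongr
    have e2 : (M / 2) ^ (1 / p) = (1 / 2 : ℝ) ^ (1 / p) * M ^ (1 / p) := by
      rw [← Real.mul_rpow (by norm_num) hM]
      congr 1
      ring
    have e3 : M / 2 * (1 / 2) ^ n = M * (1 / 2) ^ (n + 1) := by ring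
    have hMp : 0 ≤ M ^ (1 / p) := by positivity
    rw [e2, e3]
    nlinarith [mul_le_mul_of_nonneg_right hc hMp]

theorem Wp_conv_stdGaussian_le {p c : ℝ} (hp : p = 1 ∨ p = 2) (hc0 : 0 ≤ c)
    (hc : (3 / 2 : ℝ) ^ (1 / p) + c * (1 / 2 : ℝ) ^ (1 / p) ≤ c)
    (μ : Measure E) [IsProbabilityMeasure μ] (hμ : Integrable (fun x => ‖x‖ ^ (2 * p)) μ)
    (hcent : ∫ x, x ∂μ = 0) :
    Wp p (μ ∗ ProbabilityTheory.stdGaussian E) (ProbabilityTheory.stdGaussian E) ≤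
      ENNReal.ofReal (c * (∫ x, ‖x‖ ^ (2 * p) ∂μ) ^ (1 / p)) := by
  have hp1 : 1 ≤ p := by rcases hp with rfl | rfl <;> norm_num
  have hip : 0 < 1 / p := by positivity
  set M := ∫ x, ‖x‖ ^ (2 * p) ∂μ
  have hM : 0 ≤ M := integral_nonneg fun x => by positivity
  have hlim : Filter.Tendsto
      (fun n : ℕ => ENNReal.ofReal (c * M ^ (1 / p) + ((M * (1 / 2) ^ n) ^ (1 / 2 : ℝ)) ^ (1 / p)))
      Filter.atTop (nhds (ENNReal.ofReal (c * M ^ (1 / p)))) := by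
    refine ENNReal.tendsto_ofReal ?_
    have h0 : Filter.Tendsto (fun n : ℕ => M * (1 / 2 : ℝ) ^ n) Filter.atTop (nhds 0) := by
      simpa using (tendsto_pow_atTop_nhds_zero_of_lt_one (by norm_num : (0 : ℝ) ≤ 1 / 2)
        (by norm_num)).const_mul M
    have h1 := (h0.rpow_const (p := 1 / 2) (Or.inr (by norm_num))).rpow_const (p := 1 / p)
      (Or.inr hip.le)
    rw [Real.zero_rpow (by norm_num), Real.zero_rpow hip.ne'] at h1
    simpa using h1.const_add (c * M ^ (1 / p))
  refine ge_of_tendsto' hlim fun n => ?_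
  obtain ⟨τ, hτ, hle⟩ := exists_coupling_conv_le hp hc0 hc n hM μ hμ hcent le_rfl
  exact (ENNReal.rpow_le_rpow (iInf₂_le τ hτ) hip.le).trans hle

end Line

/-! ### Stochastic gradients -/

lemma stdGaussian_eq_stdGaussian_euclideanSpace (d : ℕ) :
    _root_.stdGaussian d = ProbabilityTheory.stdGaussian (EuclideanSpace ℝ (Fin d)) :=
  map_pi_eq_stdGaussian

lemma exists_const_le_Kconst_div {p : ℝ} (hp : p = 1 ∨ p = 2) :
    ∃ c : ℝ, 0 ≤ c ∧ (3 / 2 : ℝ) ^ (1 / p) + c * (1 / 2 : ℝ) ^ (1 / p) ≤ c ∧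
      c ≤ Kconst p / (1 - (1 - (2 : ℝ) ^ (-(2 * p))) ^ (1 / p)) := by
  have hK : 1 ≤ Kconst p := le_max_left _ _
  rcases hp with rfl | rfl
  · refine ⟨4, by norm_num, by norm_num, ?_⟩
    have h2 : (2 : ℝ) ^ (-(2 * 1) : ℝ) = 1 / 4 := by
      rw [Real.rpow_neg (by norm_num), show (2 * 1 : ℝ) = (2 : ℕ) by norm_num, Real.rpow_natCast]
      norm_num
    rw [h2, div_one, Real.rpow_one, le_div_iff₀ (by norm_num)]
    linarith
  · have h2 : (2 : ℝ) ^ (-(2 * 2) : ℝ) = 1 / 16 := by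
      rw [Real.rpow_neg (by norm_num), show (2 * 2 : ℝ) = (4 : ℕ) by norm_num, Real.rpow_natCast]
      norm_num
    refine ⟨5, by norm_num, ?_, ?_⟩
    · have h3 : √(3 / 2 : ℝ) ≤ 13 / 10 := Real.sqrt_le_iff.2 (by norm_num)
      have h4 : √(1 / 2 : ℝ) ≤ 71 / 100 := Real.sqrt_le_iff.2 (by norm_num)
      rw [← Real.sqrt_eq_rpow, ← Real.sqrt_eq_rpow]
      linarith
    · have h5 : (4 / 5 : ℝ) ≤ √(1 - 1 / 16) := Real.le_sqrt_of_sq_le (by norm_num)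
      have h6 : √(1 - 1 / 16 : ℝ) < 1 := by
        rw [Real.sqrt_lt' one_pos]
        norm_num
      rw [h2, ← Real.sqrt_eq_rpow, le_div_iff₀ (by linarith)]
      linarith

lemma Wp_map_smul_conv_stdGaussian_rpow_le {Ω : Type*} [MeasurableSpace Ω] {Γ : Measure Ω}
    [IsProbabilityMeasure Γ] {E : Type*} [NormedAddCommGroup E] [InnerProductSpace ℝ E]
    [FiniteDimensional ℝ E] [MeasurableSpace E] [BorelSpace E] {p c s : ℝ}
    (hp : p = 1 ∨ p = 2) (hc0 : 0 ≤ c)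
    (hc : (3 / 2 : ℝ) ^ (1 / p) + c * (1 / 2 : ℝ) ^ (1 / p) ≤ c) (hs : 0 ≤ s) {Y : Ω → E}
    (hY : Measurable Y) (hYp : Integrable (fun ω => ‖Y ω‖ ^ (2 * p)) Γ) (hY0 : ∫ ω, Y ω ∂Γ = 0) :
    Wp p ((Γ.map fun ω => s • Y ω) ∗ ProbabilityTheory.stdGaussian E)
        (ProbabilityTheory.stdGaussian E) ^ p ≤
      ENNReal.ofReal ((c * s ^ 2) ^ p * ∫ ω, ‖Y ω‖ ^ (2 * p) ∂Γ) := by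
  have hp1 : 1 ≤ p := by rcases hp with rfl | rfl <;> norm_num
  have hm : AEMeasurable (fun ω => s • Y ω) Γ := by fun_prop
  have hnorm : (fun ω => ‖s • Y ω‖ ^ (2 * p)) = fun ω => s ^ (2 * p) * ‖Y ω‖ ^ (2 * p) := by
    funext ω
    rw [norm_smul, Real.norm_of_nonneg hs, Real.mul_rpow hs (norm_nonneg _)]
  have hmeas : AEStronglyMeasurable (fun x : E => ‖x‖ ^ (2 * p)) (Γ.map fun ω => s • Y ω) :=
    Measurable.aestronglyMeasurable (by fun_prop)
  have := Measure.isProbabilityMeasure_map hm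
  have hint : ∫ x, ‖x‖ ^ (2 * p) ∂(Γ.map fun ω => s • Y ω) =
      s ^ (2 * p) * ∫ ω, ‖Y ω‖ ^ (2 * p) ∂Γ := by
    rw [integral_map hm hmeas, hnorm, integral_const_mul]
  have hW := Wp_conv_stdGaussian_le hp hc0 hc (Γ.map fun ω => s • Y ω)
    ((integrable_map_measure hmeas hm).2 ((hYp.const_mul (s ^ (2 * p))).congr
      (Filter.Eventually.of_forall fun ω => (congr_fun hnorm ω).symm)))
    (by rw [integral_map hm (by fun_prop), integral_smul, hY0, smul_zero])
  have hI : 0 ≤ ∫ ω, ‖Y ω‖ ^ (2 * p) ∂Γ := integral_nonneg fun ω => by positivity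
  rw [hint] at hW
  refine (ENNReal.rpow_le_rpow hW (by linarith)).trans_eq ?_
  rw [ENNReal.ofReal_rpow_of_nonneg (by positivity) (by linarith)]
  congr 1
  rw [Real.mul_rpow hc0 (by positivity), ← Real.rpow_mul (by positivity),
    one_div_mul_cancel (by linarith), Real.rpow_one, Real.mul_rpow hc0 (by positivity),
    ← Real.rpow_natCast, ← Real.rpow_mul hs]
  push_cast
  ring

/-- plug-in bound (i), under a finite `2p`-th stochastic gradient moment. -/
theorem sg_convolution_bound_moment
    {Ω : Type*} [MeasurableSpace Ω] [TopologicalSpace Ω] [PolishSpace Ω] [BorelSpace Ω]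
    (Γ : Measure Ω) [IsProbabilityMeasure Γ]
    (d : ℕ) (V : EuclideanSpace ℝ (Fin d) → ℝ) (hV : Differentiable ℝ V)
    (πm : Measure (EuclideanSpace ℝ (Fin d))) [IsProbabilityMeasure πm]
    (G : EuclideanSpace ℝ (Fin d) → Ω → EuclideanSpace ℝ (Fin d))
    (hGmeas : Measurable (Function.uncurry G))
    (hunbiased : ∀ x, ∫ ω, G x ω ∂Γ = gradient V x)
    (h γ : ℝ) (hh : 0 < h) (hγ : 0 < γ)
    (p : ℝ) (hp : p = 1 ∨ p = 2)
    (hmom : Integrable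
      (fun q : EuclideanSpace ℝ (Fin d) × Ω => ‖G q.1 q.2 - gradient V q.1‖ ^ (2 * p))
      (πm.prod Γ)) :
    (∫⁻ x, (Wp p
        ((Γ.map fun ω => (h * Real.exp (-(h * γ) / 2)) • (gradient V x - G x ω)) ∗
          stdGaussian d)
        (stdGaussian d)) ^ p ∂πm) ^ (1 / p) ≤
      ENNReal.ofReal
        ((Kconst p / (1 - (1 - (2 : ℝ) ^ (-(2 * p))) ^ (1 / p))) *
          (h ^ 2 * Real.exp (-(h * γ))) *
          (((∫ q : EuclideanSpace ℝ (Fin d) × Ω,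
              ‖G q.1 q.2 - gradient V q.1‖ ^ (2 * p) ∂(πm.prod Γ)) ^ (1 / (2 * p))) ^ 2)) := by
  rw [stdGaussian_eq_stdGaussian_euclideanSpace]
  have hp1 : 1 ≤ p := by rcases hp with rfl | rfl <;> norm_num
  obtain ⟨c, hc0, hc, hcK⟩ := exists_const_le_Kconst_div hp
  have hgrad : Measurable (gradient V) := by
    have := (hGmeas.stronglyMeasurable.integral_prod_right (ν := Γ)).measurable
    simpa [Function.uncurry, hunbiased] using this
  set s := h * Real.exp (-(h * γ) / 2) with hs
  have hs0 : 0 ≤ s := by positivity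
  have hs2 : s ^ 2 = h ^ 2 * Real.exp (-(h * γ)) := by
    rw [hs, mul_pow, ← Real.exp_nat_mul]
    congr 2
    push_cast
    ring
  set I := ∫ q : EuclideanSpace ℝ (Fin d) × Ω,
    ‖G q.1 q.2 - gradient V q.1‖ ^ (2 * p) ∂(πm.prod Γ) with hI
  have hI0 : 0 ≤ I := integral_nonneg fun q => by positivity
  have hW : ∀ᵐ x ∂πm,
      Wp p ((Γ.map fun ω => s • (gradient V x - G x ω)) ∗
        ProbabilityTheory.stdGaussian (EuclideanSpace ℝ (Fin d)))
        (ProbabilityTheory.stdGaussian (EuclideanSpace ℝ (Fin d))) ^ p ≤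
      ENNReal.ofReal ((c * s ^ 2) ^ p * ∫ ω, ‖G x ω - gradient V x‖ ^ (2 * p) ∂Γ) := by
    filter_upwards [hmom.prod_right_ae] with x hx
    have hGx : Measurable (G x) := hGmeas.comp measurable_prodMk_left
    have hdiff : Measurable fun ω => gradient V x - G x ω := hGx.const_sub _
    simp_rw [norm_sub_rev (G x _)] at hx ⊢
    have hL1 : Integrable (fun ω => gradient V x - G x ω) Γ := by
      refine ((integrable_const (1 : ℝ)).add hx).mono' hdiff.aestronglyMeasurable
        (Filter.Eventually.of_forall fun ω => ?_)
      simp only [Pi.add_apply]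
      rcases le_total ‖gradient V x - G x ω‖ 1 with h1 | h1
      · have := Real.rpow_nonneg (norm_nonneg (gradient V x - G x ω)) (2 * p)
        linarith
      · have := Real.self_le_rpow_of_one_le h1 (by linarith : 1 ≤ 2 * p)
        linarith
    have hGi : Integrable (G x) Γ := by
      exact ((integrable_const (gradient V x)).sub hL1).congr
        (Filter.Eventually.of_forall fun ω => sub_sub_cancel _ _)
    refine Wp_map_smul_conv_stdGaussian_rpow_le hp hc0 hc hs0 hdiff hx ?_
    rw [integral_sub (integrable_const _) hGi, hunbiased]
    simp
  refine (ENNReal.rpow_le_rpow (lintegral_mono_ae hW) (by positivity)).trans ?_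
  rw [← ofReal_integral_eq_lintegral_ofReal (hmom.integral_prod_left.const_mul _)
    (Filter.Eventually.of_forall fun x => mul_nonneg (by positivity)
      (integral_nonneg fun ω => by positivity)), integral_const_mul,
    ← integral_prod _ hmom, ← hI, ENNReal.ofReal_rpow_of_nonneg (by positivity) (by positivity),
    Real.mul_rpow (by positivity) hI0, ← Real.rpow_mul (by positivity),
    mul_one_div_cancel (by linarith), Real.rpow_one]
  refine ENNReal.ofReal_le_ofReal ?_
  have hIp : (I ^ (1 / (2 * p))) ^ 2 = I ^ (1 / p) := by
    rw [← Real.rpow_natCast, ← Real.rpow_mul hI0]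
    congr 1
    push_cast
    field_simp
  rw [hIp, hs2]
  gcongr

end
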